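/- Sufficient condition for a local spread to lower surplus: let the experiment E' differ from E by a local mean preserving spread at s_j ∈ S. If ρ·(1−c)·p_H(s_j) ≤ c·(1−ρ)·p_L(s_j) and ρ·(1−c)·p_H(s_j)^{n−1}·p'_H(s_{j+1}) ≤ c·(1−ρ)·p_L(s_j)^{n−1}·p'_L(s_{j+1}), then total surplus in the most selective equilibrium under E' is weakly lower than total surplus in the most selective equilibrium under E. -/

import Mathlib

open Finset Filter Topology

noncomputable section

/-- Probability that a single buyer rejects the seller, given conditional signal
distribution `p` and strategy `σ`: `r_θ(σ) = 1 - Σ_s p_θ(s)·σ(s)`. -/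
def rej {m : ℕ} (p σ : Fin m → ℝ) : ℝ := 1 - ∑ s, p s * σ s

/-- `ν_θ(σ) = (1/n)·Σ_{k=0}^{n-1} r_θ(σ)^k`: probability of being visited. -/
def visit (n : ℕ) {m : ℕ} (p σ : Fin m → ℝ) : ℝ :=
  (1 / (n : ℝ)) * ∑ k ∈ Finset.range n, rej p σ ^ k

/-- Interim belief `Ψ(σ) = ρ·ν_H(σ) / (ρ·ν_H(σ) + (1-ρ)·ν_L(σ))`. -/
def interim (ρ : ℝ) (n : ℕ) {m : ℕ} (pL pH σ : Fin m → ℝ) : ℝ :=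
  ρ * visit n pH σ / (ρ * visit n pH σ + (1 - ρ) * visit n pL σ)

/-- Posterior belief `Q_ψ(s) = ψ·p_H(s) / (ψ·p_H(s) + (1-ψ)·p_L(s))`. -/
def post {m : ℕ} (ψ : ℝ) (pL pH : Fin m → ℝ) (s : Fin m) : ℝ :=
  ψ * pH s / (ψ * pH s + (1 - ψ) * pL s)

/-- A strategy maps each signal to an acceptance probability in `[0,1]`. -/
def IsStrategy {m : ℕ} (σ : Fin m → ℝ) : Prop := ∀ s, 0 ≤ σ s ∧ σ s ≤ 1

/-- `σ` is an equilibrium strategy: with `ψ* = Ψ(σ)`, accept for sure when the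
posterior exceeds `c`, reject for sure when it falls below `c`. -/
def IsEquilibrium (ρ c : ℝ) (n : ℕ) {m : ℕ} (pL pH σ : Fin m → ℝ) : Prop :=
  IsStrategy σ ∧
  ∀ s : Fin m,
    (c < post (interim ρ n pL pH σ) pL pH s → σ s = 1) ∧
    (post (interim ρ n pL pH σ) pL pH s < c → σ s = 0)

/-- Total surplus `Π(σ) = (1-c)·ρ·(1-r_H(σ)^n) - c·(1-ρ)·(1-r_L(σ)^n)`. -/
def surplus (ρ c : ℝ) (n : ℕ) {m : ℕ} (pL pH σ : Fin m → ℝ) : ℝ :=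
  (1 - c) * ρ * (1 - rej pH σ ^ n) - c * (1 - ρ) * (1 - rej pL σ ^ n)

/-- The most selective equilibrium strategy. -/
def MostSelective (ρ c : ℝ) (n : ℕ) {m : ℕ} (pL pH σ : Fin m → ℝ) : Prop :=
  IsEquilibrium ρ c n pL pH σ ∧
  ∀ σ' : Fin m → ℝ, IsEquilibrium ρ c n pL pH σ' → ∀ s, σ s ≤ σ' s

/-- The least selective equilibrium strategy. -/
def LeastSelective (ρ c : ℝ) (n : ℕ) {m : ℕ} (pL pH σ : Fin m → ℝ) : Prop :=
  IsEquilibrium ρ c n pL pH σ ∧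
  ∀ σ' : Fin m → ℝ, IsEquilibrium ρ c n pL pH σ' → ∀ s, σ' s ≤ σ s

/-- An experiment: `p_L, p_H` are probability mass functions with full joint support,
indexed so that likelihood ratios are nondecreasing. -/
def IsExperiment {m : ℕ} (pL pH : Fin m → ℝ) : Prop :=
  (∀ s, 0 ≤ pL s) ∧ (∀ s, 0 ≤ pH s) ∧
  (∑ s, pL s = 1) ∧ (∑ s, pH s = 1) ∧
  (∀ s, 0 < pL s + pH s) ∧
  (∀ i j : Fin m, i ≤ j → pH i * pL j ≤ pH j * pL i)

/-- A strategy is monotone: a positive acceptance probability at `s_i` forces sure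
acceptance at every signal with strictly higher likelihood ratio. -/
def MonotoneStrategy {m : ℕ} (pL pH σ : Fin m → ℝ) : Prop :=
  ∀ i j : Fin m, 0 < σ i → pH i * pL j < pH j * pL i → σ j = 1

/-! ### Visit probabilities and the equilibrium condition in product form -/

lemma rej_nonneg {m : ℕ} {p σ : Fin m → ℝ} (hp : ∀ s, 0 ≤ p s) (hsum : ∑ s, p s = 1)
    (hσ : IsStrategy σ) : 0 ≤ rej p σ := by
  have h : ∑ s, p s * σ s ≤ ∑ s, p s :=
    Finset.sum_le_sum fun s _ => mul_le_of_le_one_right (hp s) (hσ s).2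
  unfold rej
  linarith

lemma visit_pos {n m : ℕ} (hn : 1 ≤ n) {p σ : Fin m → ℝ} (hr : 0 ≤ rej p σ) :
    0 < visit n p σ := by
  have hn' : (0 : ℝ) < n := by exact_mod_cast hn
  have h : rej p σ ^ 0 ≤ ∑ k ∈ Finset.range n, rej p σ ^ k :=
    Finset.single_le_sum (f := fun k => rej p σ ^ k) (fun k _ => pow_nonneg hr k)
      (Finset.mem_range.2 hn)
  rw [pow_zero] at h
  unfold visit
  positivity

lemma visit_mono {n m : ℕ} {p q σ : Fin m → ℝ} (hr : 0 ≤ rej p σ) (h : rej p σ ≤ rej q σ) :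
    visit n p σ ≤ visit n q σ := by
  unfold visit
  gcongr

/-- The posterior of a signal of positive probability compares with `c` as the weighted
likelihoods compare with each other. -/
lemma post_interim_eq {ρ : ℝ} (hρ : ρ ∈ Set.Ioo (0 : ℝ) 1) {n m : ℕ} {pL pH σ : Fin m → ℝ}
    (hL : 0 < visit n pL σ) (hH : 0 < visit n pH σ) (s : Fin m) :
    post (interim ρ n pL pH σ) pL pH s =
      ρ * visit n pH σ * pH s / (ρ * visit n pH σ * pH s + (1 - ρ) * visit n pL σ * pL s) := by
  have h1 : 0 < ρ * visit n pH σ := mul_pos hρ.1 hH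
  have h2 : 0 < (1 - ρ) * visit n pL σ := mul_pos (by linarith [hρ.2]) hL
  unfold post interim
  set A := ρ * visit n pH σ
  set B := (1 - ρ) * visit n pL σ
  have hAB : A + B ≠ 0 := by positivity
  have e1 : A / (A + B) * pH s = A * pH s / (A + B) := by ring
  have e2 : (1 - A / (A + B)) * pL s = B * pL s / (A + B) := by
    field_simp
    ring
  rw [e1, e2, ← add_div, div_div_div_cancel_right₀ hAB]

/-- Marginal private gain, up to a positive factor, of accepting a signal with likelihoods
`x` in state `L` and `y` in state `H`, when all other buyers use `σ`. -/
def gain (ρ c : ℝ) (n : ℕ) {m : ℕ} (pL pH σ : Fin m → ℝ) (x y : ℝ) : ℝ :=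
  ρ * (1 - c) * visit n pH σ * y - c * (1 - ρ) * visit n pL σ * x

/-- The experiment with likelihoods `w • f` and `w • g`: common likelihood ratios `g / f`,
with total mass of each outcome scaled by `w`. -/
def scaled {m : ℕ} (w f : Fin m → ℝ) : Fin m → ℝ := fun s => w s * f s

section Weighted

variable {ρ c : ℝ} {n M : ℕ} {f g w w' σ : Fin M → ℝ}

/-- Both scaled likelihoods are probability mass functions. -/
structure IsWeight (f g w : Fin M → ℝ) : Prop where
  nonneg : ∀ s, 0 ≤ w s
  sumL : ∑ s, w s * f s = 1
  sumH : ∑ s, w s * g s = 1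

/-- Nonnegative, nowhere vanishing likelihoods in order of nondecreasing ratio. -/
structure IsRatio (f g : Fin M → ℝ) : Prop where
  nonnegL : ∀ s, 0 ≤ f s
  nonnegH : ∀ s, 0 ≤ g s
  pos : ∀ s, 0 < f s + g s
  mono : ∀ i k, i ≤ k → g i * f k ≤ g k * f i

lemma IsRatio.gain_nonpos_of_le (hR : IsRatio f g) {a b : ℝ} (ha : 0 < a)
    {i k : Fin M} (hik : i ≤ k) (hk : a * g k - b * f k ≤ 0) : a * g i - b * f i ≤ 0 := by
  have h0 := hR.mono i k hik
  have h1 := hR.nonnegL i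
  have hfk : 0 < f k := by
    by_contra h
    have h2 : f k = 0 := le_antisymm (not_lt.1 h) (hR.nonnegL k)
    have h3 := hR.pos k
    rw [h2] at h3 hk
    nlinarith
  have h4 : (a * g i - b * f i) * f k ≤ 0 := by
    have h5 := mul_le_mul_of_nonneg_left h0 ha.le
    have h6 := mul_le_mul_of_nonneg_right hk h1
    nlinarith
  exact nonpos_of_mul_nonpos_left h4 hfk

lemma IsRatio.gain_nonneg_of_le (hR : IsRatio f g) {a b : ℝ} (hb : 0 < b)
    {i k : Fin M} (hik : i ≤ k) (hi : 0 ≤ a * g i - b * f i) : 0 ≤ a * g k - b * f k := by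
  have h0 := hR.mono i k hik
  have h1 := hR.nonnegH k
  have hgi : 0 < g i := by
    by_contra h
    have h2 : g i = 0 := le_antisymm (not_lt.1 h) (hR.nonnegH i)
    have h3 := hR.pos i
    rw [h2] at h3 hi
    nlinarith
  have h4 : 0 ≤ (a * g k - b * f k) * g i := by
    have h5 := mul_le_mul_of_nonneg_left h0 hb.le
    have h6 := mul_nonneg hi h1
    nlinarith
  exact nonneg_of_mul_nonneg_left h4 hgi

lemma IsWeight.rejL (hw : IsWeight f g w) (hR : IsRatio f g) (hσ : IsStrategy σ) :
    0 ≤ rej (scaled w f) σ :=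
  rej_nonneg (fun s => mul_nonneg (hw.nonneg s) (hR.nonnegL s)) hw.sumL hσ

lemma IsWeight.rejH (hw : IsWeight f g w) (hR : IsRatio f g) (hσ : IsStrategy σ) :
    0 ≤ rej (scaled w g) σ :=
  rej_nonneg (fun s => mul_nonneg (hw.nonneg s) (hR.nonnegH s)) hw.sumH hσ

lemma isEquilibrium_iff (hρ : ρ ∈ Set.Ioo (0 : ℝ) 1) (hc : c ∈ Set.Ioo (0 : ℝ) 1) (hn : 1 ≤ n)
    (hR : IsRatio f g) (hw : IsWeight f g w) :
    IsEquilibrium ρ c n (scaled w f) (scaled w g) σ ↔ IsStrategy σ ∧ ∀ s,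
      (w s = 0 → σ s = 0) ∧
      (0 < w s → 0 < gain ρ c n (scaled w f) (scaled w g) σ (f s) (g s) → σ s = 1) ∧
      (0 < w s → gain ρ c n (scaled w f) (scaled w g) σ (f s) (g s) < 0 → σ s = 0) := by
  unfold IsEquilibrium
  refine and_congr_right fun hσ => forall_congr' fun s => ?_
  have hL := visit_pos hn (hw.rejL hR hσ)
  have hH := visit_pos hn (hw.rejH hR hσ)
  rw [post_interim_eq hρ hL hH s]
  unfold gain
  set vL := visit n (scaled w f) σ
  set vH := visit n (scaled w g) σ
  rcases (hw.nonneg s).eq_or_lt with h | h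
  · have hs : scaled w f s = 0 ∧ scaled w g s = 0 := by simp [scaled, ← h]
    simp [hs.1, hs.2, ← h, hc.1, hc.1.not_gt]
  · have hA : 0 < ρ * vH := mul_pos hρ.1 hH
    have hB : 0 < (1 - ρ) * vL := mul_pos (by linarith [hρ.2]) hL
    have hf := hR.nonnegL s
    have hg := hR.nonnegH s
    have hd : 0 < ρ * vH * g s + (1 - ρ) * vL * f s := by
      rcases hf.eq_or_lt with h0 | h0
      · have := hR.pos s
        have : 0 < g s := by linarith
        positivity
      · positivity
    have e : ρ * vH * scaled w g s /
        (ρ * vH * scaled w g s + (1 - ρ) * vL * scaled w f s) =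
        ρ * vH * g s / (ρ * vH * g s + (1 - ρ) * vL * f s) := by
      have e1 : ρ * vH * scaled w g s = w s * (ρ * vH * g s) := by unfold scaled; ring
      have e2 : (1 - ρ) * vL * scaled w f s = w s * ((1 - ρ) * vL * f s) := by unfold scaled; ring
      rw [e1, e2, ← mul_add, mul_div_mul_left _ _ h.ne']
    rw [e, lt_div_iff₀ hd, div_lt_iff₀ hd]
    have i1 : c * (ρ * vH * g s + (1 - ρ) * vL * f s) < ρ * vH * g s ↔
        0 < ρ * (1 - c) * vH * g s - c * (1 - ρ) * vL * f s := by
      constructor <;> intro h <;> linarith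
    have i2 : ρ * vH * g s < c * (ρ * vH * g s + (1 - ρ) * vL * f s) ↔
        ρ * (1 - c) * vH * g s - c * (1 - ρ) * vL * f s < 0 := by
      constructor <;> intro h <;> linarith
    rw [i1, i2]
    simp [h, h.ne']

/-! ### Existence of equilibria at or above a given cutoff -/

/-- The cutoff strategy accepting the signals above `u`, mixing at the cutoff, and rejecting
signals of probability zero. -/
def cutoff (w : Fin M → ℝ) (u : ℝ) (i : Fin M) : ℝ :=
  if w i = 0 then 0 else max 0 (min 1 ((i : ℝ) + 1 - u))

lemma isStrategy_cutoff (w : Fin M → ℝ) (u : ℝ) : IsStrategy (cutoff w u) := by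
  intro s
  unfold cutoff
  split_ifs
  · simp
  · exact ⟨le_max_left _ _, max_le zero_le_one (min_le_left _ _)⟩

lemma cutoff_eq_zero {u : ℝ} {i : Fin M} (h : (i : ℝ) + 1 ≤ u) : cutoff w u i = 0 := by
  unfold cutoff
  split_ifs
  · rfl
  · exact max_eq_left ((min_le_right _ _).trans (by linarith))

lemma cutoff_eq_one {u : ℝ} {i : Fin M} (hi : 0 < w i) (h : u ≤ (i : ℝ)) :
    cutoff w u i = 1 := by
  unfold cutoff
  rw [if_neg hi.ne', min_eq_left (by linarith), max_eq_right zero_le_one]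

lemma continuous_cutoff (w : Fin M → ℝ) (i : Fin M) : Continuous fun u => cutoff w u i := by
  unfold cutoff
  split_ifs <;> fun_prop

lemma continuous_gain_cutoff (w pL pH : Fin M → ℝ) (x y : ℝ) :
    Continuous fun u => gain ρ c n pL pH (cutoff w u) x y := by
  have h := continuous_cutoff w
  unfold gain visit rej
  fun_prop

lemma IsRatio.gain_weights (hρ : ρ ∈ Set.Ioo (0 : ℝ) 1) (hc : c ∈ Set.Ioo (0 : ℝ) 1)
    (hn : 1 ≤ n) (hR : IsRatio f g) (hw : IsWeight f g w) (hσ : IsStrategy σ) :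
    0 < ρ * (1 - c) * visit n (scaled w g) σ ∧ 0 < c * (1 - ρ) * visit n (scaled w f) σ := by
  have h1 : 0 < 1 - c := by linarith [hc.2]
  have h2 : 0 < 1 - ρ := by linarith [hρ.2]
  exact ⟨mul_pos (mul_pos hρ.1 h1) (visit_pos hn (hw.rejH hR hσ)),
    mul_pos (mul_pos hc.1 h2) (visit_pos hn (hw.rejL hR hσ))⟩

/-- A cutoff strategy at `u` is an equilibrium when rejection is optimal up to the signal just
below `u` and acceptance is optimal from the first signal above `u` on. -/
lemma isEquilibrium_cutoff (hρ : ρ ∈ Set.Ioo (0 : ℝ) 1) (hc : c ∈ Set.Ioo (0 : ℝ) 1)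
    (hn : 1 ≤ n) (hR : IsRatio f g) (hw : IsWeight f g w) {u : ℝ}
    (hrej : ∀ i : Fin M, (i : ℝ) < u →
      gain ρ c n (scaled w f) (scaled w g) (cutoff w u) (f i) (g i) ≤ 0)
    (hacc : ∀ i : Fin M, u < (i : ℝ) + 1 →
      0 ≤ gain ρ c n (scaled w f) (scaled w g) (cutoff w u) (f i) (g i)) :
    IsEquilibrium ρ c n (scaled w f) (scaled w g) (cutoff w u) := by
  rw [isEquilibrium_iff hρ hc hn hR hw]
  refine ⟨isStrategy_cutoff w u, fun s => ⟨fun h => by simp [cutoff, h], fun h hs => ?_,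
    fun h hs => ?_⟩⟩
  · exact cutoff_eq_one h (le_of_not_gt fun h' => absurd (hrej s h') hs.not_ge)
  · exact cutoff_eq_zero (le_of_not_gt fun h' => absurd (hacc s h') hs.not_ge)

lemma exists_equilibrium_cutoff (hρ : ρ ∈ Set.Ioo (0 : ℝ) 1) (hc : c ∈ Set.Ioo (0 : ℝ) 1)
    (hn : 1 ≤ n) (hR : IsRatio f g) (hw : IsWeight f g w) (j : Fin M)
    (hj : gain ρ c n (scaled w f) (scaled w g) (cutoff w (j + 1)) (f j) (g j) ≤ 0) :
    ∃ u : ℝ, (j : ℝ) + 1 ≤ u ∧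
      IsEquilibrium ρ c n (scaled w f) (scaled w g) (cutoff w u) := by
  classical
  have hdown : ∀ (u : ℝ) (i k : Fin M), i ≤ k →
      gain ρ c n (scaled w f) (scaled w g) (cutoff w u) (f k) (g k) ≤ 0 →
      gain ρ c n (scaled w f) (scaled w g) (cutoff w u) (f i) (g i) ≤ 0 := fun u i k hik h =>
    have hp := hR.gain_weights hρ hc hn hw (isStrategy_cutoff w u)
    hR.gain_nonpos_of_le hp.1 hik h
  have hup : ∀ (u : ℝ) (i k : Fin M), i ≤ k →
      0 ≤ gain ρ c n (scaled w f) (scaled w g) (cutoff w u) (f i) (g i) →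
      0 ≤ gain ρ c n (scaled w f) (scaled w g) (cutoff w u) (f k) (g k) := fun u i k hik h =>
    have hp := hR.gain_weights hρ hc hn hw (isStrategy_cutoff w u)
    hR.gain_nonneg_of_le hp.2 hik h
  have hex : ∃ k : ℕ, (j : ℕ) + 1 ≤ k ∧ ∀ i : Fin M, (i : ℕ) = k →
      0 ≤ gain ρ c n (scaled w f) (scaled w g) (cutoff w k) (f i) (g i) :=
    ⟨M, j.2, fun i hi => absurd i.2 (by omega)⟩
  obtain ⟨hk1, hk2⟩ := Nat.find_spec hex
  have hmin : ∀ l < Nat.find hex, _ := fun l hl => Nat.find_min hex hl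
  have hkM : Nat.find hex ≤ M := Nat.find_min' hex ⟨j.2, fun i hi => absurd i.2 (by omega)⟩
  generalize Nat.find hex = k at hk1 hk2 hmin hkM
  have hacc : ∀ i : Fin M, (k : ℝ) < (i : ℝ) + 1 →
      0 ≤ gain ρ c n (scaled w f) (scaled w g) (cutoff w k) (f i) (g i) := by
    intro i hi
    have hi' : k ≤ (i : ℕ) := by
      have : k < (i : ℕ) + 1 := by exact_mod_cast hi
      omega
    exact hup k ⟨k, hi'.trans_lt i.2⟩ i hi' (hk2 _ rfl)
  obtain ⟨l, rfl⟩ : ∃ l, k = l + 1 := ⟨k - 1, by omega⟩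
  let s : Fin M := ⟨l, by omega⟩
  by_cases hs : gain ρ c n (scaled w f) (scaled w g) (cutoff w ((l + 1 : ℕ) : ℝ))
      (f s) (g s) ≤ 0
  · refine ⟨(l + 1 : ℕ), by exact_mod_cast hk1,
      isEquilibrium_cutoff hρ hc hn hR hw (fun i hi => ?_) hacc⟩
    have hi' : (i : ℕ) < l + 1 := by exact_mod_cast hi
    exact hdown _ i s (Fin.le_def.2 (by simp only [s]; omega)) hs
  · have hjl : (j : ℕ) + 1 ≤ l := by
      by_contra h
      have hl : s = j := Fin.ext (by simp only [s]; omega)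
      have hl' : l = (j : ℕ) := by omega
      apply hs
      rw [hl, hl']
      exact_mod_cast hj
    have hneg : gain ρ c n (scaled w f) (scaled w g) (cutoff w (l : ℝ)) (f s) (g s) < 0 := by
      by_contra h
      refine hmin l (by omega) ⟨hjl, fun i hi => ?_⟩
      have : i = s := Fin.ext hi
      rw [this]
      exact not_lt.1 h
    obtain ⟨u, ⟨hu1, hu2⟩, hu⟩ := intermediate_value_Icc (a := (l : ℝ)) (b := ((l + 1 : ℕ) : ℝ))
      (by push_cast; linarith)
      (continuous_gain_cutoff (ρ := ρ) (c := c) (n := n) w (scaled w f) (scaled w g)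
        (f s) (g s)).continuousOn ⟨hneg.le, (not_le.1 hs).le⟩
    simp only at hu
    have hjl' : (j : ℝ) + 1 ≤ l := by exact_mod_cast hjl
    refine ⟨u, hjl'.trans hu1, isEquilibrium_cutoff hρ hc hn hR hw (fun i hi => ?_)
      (fun i hi => ?_)⟩
    · have hi' : (i : ℕ) < l + 1 := by exact_mod_cast hi.trans_le hu2
      exact hdown _ i s (Fin.le_def.2 (by simp only [s]; omega)) hu.le
    · have hi' : l < (i : ℕ) + 1 := by exact_mod_cast hu1.trans_lt hi
      exact hup _ s i (Fin.le_def.2 (by simp only [s]; omega)) hu.ge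

/-- Cutoff strategies are adversely selected against: a buyer facing state `H` is rejected
less often than one facing state `L`. -/
lemma rej_cutoff_le (hR : IsRatio f g) (hw : IsWeight f g w) (j : Fin M) :
    rej (scaled w g) (cutoff w (j + 1)) ≤ rej (scaled w f) (cutoff w (j + 1)) := by
  have hlow : ∀ i : Fin M, i ≤ j → cutoff w ((j : ℝ) + 1) i = 0 := fun i hi =>
    cutoff_eq_zero (by have : ((i : ℕ) : ℝ) ≤ (j : ℕ) := by exact_mod_cast hi
                       linarith)
  have hhigh : ∀ i : Fin M, j < i → w i * (1 - cutoff w ((j : ℝ) + 1) i) = 0 := fun i hi => by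
    rcases (hw.nonneg i).eq_or_lt with h | h
    · simp [← h]
    · rw [cutoff_eq_one h (by exact_mod_cast Nat.succ_le_of_lt hi)]
      simp
  unfold rej scaled
  rcases le_total (f j) (g j) with h | h
  · have : ∑ s, w s * f s * cutoff w (j + 1) s ≤ ∑ s, w s * g s * cutoff w (j + 1) s := by
      refine Finset.sum_le_sum fun s _ => ?_
      rcases le_or_gt s j with hs | hs
      · simp [hlow s hs]
      · have h1 := hR.gain_nonneg_of_le (a := 1) (b := 1) one_pos hs.le (by linarith)
        have h2 : f s ≤ g s := by linarith
        have := (isStrategy_cutoff w ((j : ℝ) + 1) s).1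
        have := hw.nonneg s
        gcongr
    linarith
  · have : ∑ s, w s * g s * (1 - cutoff w (j + 1) s) ≤
        ∑ s, w s * f s * (1 - cutoff w (j + 1) s) := by
      refine Finset.sum_le_sum fun s _ => ?_
      rcases le_or_gt s j with hs | hs
      · have h1 := hR.gain_nonpos_of_le (a := 1) (b := 1) one_pos hs (by linarith)
        have h2 : g s ≤ f s := by linarith
        have := hw.nonneg s
        simp only [hlow s hs, sub_zero, mul_one]
        gcongr
      · have := hhigh s hs
        rw [mul_right_comm, this, mul_right_comm, this]
        simp
    simp only [mul_sub, mul_one, Finset.sum_sub_distrib, hw.sumL, hw.sumH] at this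
    exact this

/-- If a signal is not worth accepting under the prior, the most selective equilibrium rejects
it and all signals of lower likelihood ratio. -/
lemma MostSelective.eq_zero_of_le (hρ : ρ ∈ Set.Ioo (0 : ℝ) 1) (hc : c ∈ Set.Ioo (0 : ℝ) 1)
    (hn : 1 ≤ n) (hR : IsRatio f g) (hw : IsWeight f g w)
    (hσ : MostSelective ρ c n (scaled w f) (scaled w g) σ) {j : Fin M}
    (hj : ρ * (1 - c) * g j ≤ c * (1 - ρ) * f j) {i : Fin M} (hi : i ≤ j) : σ i = 0 := by
  have hstr := isStrategy_cutoff w ((j : ℝ) + 1)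
  have hv := visit_mono (n := n) (hw.rejH hR hstr) (rej_cutoff_le hR hw j)
  have hpos := visit_pos hn (hw.rejL hR hstr)
  obtain ⟨u, hu, he⟩ := exists_equilibrium_cutoff hρ hc hn hR hw j (by
    unfold gain
    have h1 : 0 ≤ ρ * (1 - c) * g j :=
      mul_nonneg (mul_nonneg hρ.1.le (by linarith [hc.2])) (hR.nonnegH j)
    have h2 := mul_le_mul_of_nonneg_left hv h1
    have h3 := mul_le_mul_of_nonneg_right hj hpos.le
    linarith)
  have hij : ((i : ℕ) : ℝ) ≤ (j : ℕ) := by exact_mod_cast hi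
  have h := hσ.2 _ he i
  rw [cutoff_eq_zero (by linarith)] at h
  exact le_antisymm h (hσ.1.1 i).1

/-! ### Structure of the most selective equilibrium -/

lemma rej_update_pair {m : ℕ} (p σ : Fin m → ℝ) {i k : Fin m} (hik : k ≠ i) (x y : ℝ)
    (h : p k * (x - σ k) + p i * (y - σ i) = 0) :
    rej p (Function.update (Function.update σ k x) i y) = rej p σ := by
  have e : ∑ s, (p s * Function.update (Function.update σ k x) i y s - p s * σ s) =
      p k * (x - σ k) + p i * (y - σ i) := by
    rw [← Finset.sum_subset (Finset.subset_univ {k, i}), Finset.sum_pair hik]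
    · simp [Function.update_of_ne hik, mul_sub]
    · intro s _ hs
      simp only [Finset.mem_insert, Finset.mem_singleton, not_or] at hs
      simp [Function.update_of_ne hs.1, Function.update_of_ne hs.2]
  rw [Finset.sum_sub_distrib, h] at e
  unfold rej
  linarith

/-- In the most selective equilibrium, if a signal of positive probability is not accepted for
sure, then every earlier signal is rejected. -/
lemma MostSelective.eq_zero_of_lt (hρ : ρ ∈ Set.Ioo (0 : ℝ) 1) (hc : c ∈ Set.Ioo (0 : ℝ) 1)
    (hn : 1 ≤ n) (hR : IsRatio f g) (hw : IsWeight f g w)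
    (hσ : MostSelective ρ c n (scaled w f) (scaled w g) σ) {i k : Fin M} (hki : k < i)
    (hwi : 0 < w i) (hi : σ i < 1) : σ k = 0 := by
  obtain ⟨hs, he⟩ := (isEquilibrium_iff hρ hc hn hR hw).1 hσ.1
  rcases (hw.nonneg k).eq_or_lt with hwk | hwk
  · exact (he k).1 hwk.symm
  obtain ⟨ha, hb⟩ := hR.gain_weights hρ hc hn hw hs
  have hgi : gain ρ c n (scaled w f) (scaled w g) σ (f i) (g i) ≤ 0 :=
    not_lt.1 fun h => hi.ne ((he i).2.1 hwi h)
  have hgk : gain ρ c n (scaled w f) (scaled w g) σ (f k) (g k) ≤ 0 :=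
    hR.gain_nonpos_of_le ha hki.le hgi
  rcases hgk.lt_or_eq with h | h
  · exact (he k).2.2 hwk h
  have hgi0 : gain ρ c n (scaled w f) (scaled w g) σ (f i) (g i) = 0 :=
    le_antisymm hgi (hR.gain_nonneg_of_le hb hki.le h.ge)
  by_contra hne
  have hσk : 0 < σ k := lt_of_le_of_ne (hs k).1 (Ne.symm hne)
  have hgi1 := hgi0
  have hgk1 := h
  unfold gain at hgi1 hgk1
  set a := ρ * (1 - c) * visit n (scaled w g) σ
  set b := c * (1 - ρ) * visit n (scaled w f) σ
  have hpos : ∀ s, a * g s - b * f s = 0 → 0 < f s := fun s h0 => by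
    by_contra h1
    have h2 : f s = 0 := le_antisymm (not_lt.1 h1) (hR.nonnegL s)
    have h3 := hR.pos s
    rw [h2] at h3 h0
    nlinarith
  have hfk := mul_pos hwk (hpos k hgk1)
  have hfi := mul_pos hwi (hpos i hgi1)
  obtain ⟨δ, hδ0, hδk, hδi⟩ : ∃ δ, 0 < δ ∧ δ ≤ σ k * (w k * f k) ∧
      δ ≤ (1 - σ i) * (w i * f i) :=
    ⟨_, lt_min (mul_pos hσk hfk) (mul_pos (by linarith) hfi), min_le_left _ _, min_le_right _ _⟩
  set x := σ k - δ / (w k * f k) with hx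
  set y := σ i + δ / (w i * f i) with hy
  have hδk' : δ / (w k * f k) ≤ σ k := (div_le_iff₀ hfk).2 hδk
  have hδi' : δ / (w i * f i) ≤ 1 - σ i := (div_le_iff₀ hfi).2 hδi
  have hδk0 : 0 < δ / (w k * f k) := div_pos hδ0 hfk
  have hδi0 : 0 < δ / (w i * f i) := div_pos hδ0 hfi
  have eL : w k * f k * (x - σ k) + w i * f i * (y - σ i) = 0 := by
    have h1 : w k * f k * (δ / (w k * f k)) = δ := mul_div_cancel₀ δ hfk.ne'
    have h2 : w i * f i * (δ / (w i * f i)) = δ := mul_div_cancel₀ δ hfi.ne'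
    rw [hx, hy]
    linear_combination h2 - h1
  have eH : w k * g k * (x - σ k) + w i * g i * (y - σ i) = 0 := by
    have h1 : a * (w k * g k * (x - σ k) + w i * g i * (y - σ i)) = 0 := by
      linear_combination b * eL + w k * (x - σ k) * hgk1 + w i * (y - σ i) * hgi1
    exact (mul_eq_zero.1 h1).resolve_left ha.ne'
  set τ := Function.update (Function.update σ k x) i y with hτ
  have hτk : τ k = x := by simp [hτ, Function.update_of_ne hki.ne]
  have hτi : τ i = y := by simp [hτ]
  have hτs : ∀ s, s ≠ k → s ≠ i → τ s = σ s := fun s h1 h2 => by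
    simp [hτ, Function.update_of_ne h1, Function.update_of_ne h2]
  have rL : rej (scaled w f) τ = rej (scaled w f) σ := rej_update_pair _ _ hki.ne _ _ eL
  have rH : rej (scaled w g) τ = rej (scaled w g) σ := rej_update_pair _ _ hki.ne _ _ eH
  have hgain : ∀ s, gain ρ c n (scaled w f) (scaled w g) τ (f s) (g s) =
      gain ρ c n (scaled w f) (scaled w g) σ (f s) (g s) := fun s => by
    simp only [gain, visit, rL, rH]
  have heq : IsEquilibrium ρ c n (scaled w f) (scaled w g) τ := by
    rw [isEquilibrium_iff hρ hc hn hR hw]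
    refine ⟨fun s => ?_, fun s => ?_⟩
    · rcases eq_or_ne s k with rfl | h1
      · rw [hτk]
        exact ⟨by linarith, by linarith [(hs s).2]⟩
      rcases eq_or_ne s i with rfl | h2
      · rw [hτi]
        exact ⟨by linarith [(hs s).1], by linarith⟩
      rw [hτs s h1 h2]
      exact hs s
    · rw [hgain]
      rcases eq_or_ne s k with rfl | h1
      · exact ⟨fun h0 => absurd h0 hwk.ne', fun _ h0 => absurd h h0.ne',
          fun _ h0 => absurd h h0.ne⟩
      rcases eq_or_ne s i with rfl | h2
      · exact ⟨fun h0 => absurd h0 hwi.ne', fun _ h0 => absurd hgi0 h0.ne',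
          fun _ h0 => absurd hgi0 h0.ne⟩
      rw [hτs s h1 h2]
      exact he s
  have := hσ.2 τ heq k
  rw [hτk] at this
  linarith

/-! ### Moving equilibria between experiments -/

lemma rej_scaled_congr (x : Fin M → ℝ) (h : ∀ s, w s ≠ w' s → σ s = 0) :
    rej (scaled w x) σ = rej (scaled w' x) σ := by
  unfold rej scaled
  congr 1
  refine Finset.sum_congr rfl fun s _ => ?_
  by_cases hs : w s = w' s
  · rw [hs]
  · simp [h s hs]

lemma IsEquilibrium.congr_weight (hρ : ρ ∈ Set.Ioo (0 : ℝ) 1) (hc : c ∈ Set.Ioo (0 : ℝ) 1)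
    (hn : 1 ≤ n) (hR : IsRatio f g) (hw : IsWeight f g w) (hw' : IsWeight f g w')
    (hσ : IsEquilibrium ρ c n (scaled w f) (scaled w g) σ) {k : Fin M}
    (hk : gain ρ c n (scaled w f) (scaled w g) σ (f k) (g k) ≤ 0)
    (hdiff : ∀ s, w s ≠ w' s → s ≤ k) (hzero : ∀ s ≤ k, σ s = 0) :
    IsEquilibrium ρ c n (scaled w' f) (scaled w' g) σ := by
  obtain ⟨hs, he⟩ := (isEquilibrium_iff hρ hc hn hR hw).1 hσ
  have ha := (hR.gain_weights hρ hc hn hw hs).1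
  have hz : ∀ s, w s ≠ w' s → σ s = 0 := fun s h => hzero s (hdiff s h)
  have hgain : ∀ s, gain ρ c n (scaled w' f) (scaled w' g) σ (f s) (g s) =
      gain ρ c n (scaled w f) (scaled w g) σ (f s) (g s) := fun s => by
    simp only [gain, visit, rej_scaled_congr f hz, rej_scaled_congr g hz]
  refine (isEquilibrium_iff hρ hc hn hR hw').2 ⟨hs, fun s => ?_⟩
  rw [hgain]
  by_cases h : w s = w' s
  · rw [← h]
    exact he s
  · have h1 : gain ρ c n (scaled w f) (scaled w g) σ (f s) (g s) ≤ 0 :=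
      hR.gain_nonpos_of_le ha (hdiff s h) hk
    exact ⟨fun _ => hz s h, fun _ h2 => absurd h1 h2.not_ge, fun _ _ => hz s h⟩

lemma surplus_congr_weight (h : ∀ s, w s ≠ w' s → σ s = 0) :
    surplus ρ c n (scaled w f) (scaled w g) σ = surplus ρ c n (scaled w' f) (scaled w' g) σ := by
  simp only [surplus, rej_scaled_congr f h, rej_scaled_congr g h]

/-! ### The surplus comparison -/

lemma weighted_pow_sub_pow_le {h l t bL bH rL rH : ℝ} (n : ℕ) (hh : 0 ≤ h) (ht : 0 ≤ t)
    (hrL : 0 ≤ rL) (hrH : 0 ≤ rH) (hbL : rL ≤ bL) (hbH : rH ≤ bH) (hb : bH ≤ t * bL)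
    (hr : rH ≤ t * rL) (hd : h * t ^ (n - 1) * (bH - rH) ≤ l * (bL - rL)) :
    h * (bH ^ n - rH ^ n) ≤ l * (bL ^ n - rL ^ n) := by
  rw [← geom_sum₂_mul bH rH n, ← geom_sum₂_mul bL rL n]
  set SH := ∑ i ∈ Finset.range n, bH ^ i * rH ^ (n - 1 - i) with hSH
  set SL := ∑ i ∈ Finset.range n, bL ^ i * rL ^ (n - 1 - i) with hSL
  have hbL0 : 0 ≤ bL := hrL.trans hbL
  have hbH0 : 0 ≤ bH := hrH.trans hbH
  have hS : SH ≤ t ^ (n - 1) * SL := by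
    rw [hSH, hSL, Finset.mul_sum]
    refine Finset.sum_le_sum fun i hi => ?_
    have hi' : i + (n - 1 - i) = n - 1 := by
      have := Finset.mem_range.1 hi
      omega
    calc bH ^ i * rH ^ (n - 1 - i) ≤ (t * bL) ^ i * (t * rL) ^ (n - 1 - i) := by gcongr
      _ = t ^ (i + (n - 1 - i)) * (bL ^ i * rL ^ (n - 1 - i)) := by
        rw [mul_pow, mul_pow, pow_add]; ring
      _ = _ := by rw [hi']
  have hSL0 : 0 ≤ SL := Finset.sum_nonneg fun i _ => by positivity
  calc h * (SH * (bH - rH)) ≤ h * (t ^ (n - 1) * SL * (bH - rH)) := by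
        have : 0 ≤ bH - rH := by linarith
        gcongr
    _ = SL * (h * t ^ (n - 1) * (bH - rH)) := by ring
    _ ≤ SL * (l * (bL - rL)) := by gcongr
    _ = _ := by ring

lemma rej_eq_sum {m : ℕ} {p : Fin m → ℝ} (hp : ∑ s, p s = 1) (σ : Fin m → ℝ) :
    rej p σ = ∑ s, p s * (1 - σ s) := by
  simp only [rej, mul_sub, mul_one, Finset.sum_sub_distrib, hp]

/-- If `σ` rejects exactly the signals up to `j` under the weights `w`, and the most selective
equilibrium `τ` under `w'` accepts all signals after `k = j + 1`, then extra acceptances under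
`τ` lower surplus. -/
lemma surplus_le_of_accept (hρ : ρ ∈ Set.Ioo (0 : ℝ) 1) (hc : c ∈ Set.Ioo (0 : ℝ) 1)
    (hn : 1 ≤ n) (hR : IsRatio f g) (hw : IsWeight f g w) (hw' : IsWeight f g w')
    {j k : Fin M} (hjk : (k : ℕ) = j + 1) (hdiff : ∀ s, w s ≠ w' s → s ≤ k)
    (hwk : w k = 0) (hwk' : 0 < w' k)
    (hcond1 : ρ * (1 - c) * g j ≤ c * (1 - ρ) * f j)
    (hcond2 : ρ * (1 - c) * g j ^ (n - 1) * g k ≤ c * (1 - ρ) * f j ^ (n - 1) * f k)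
    {τ : Fin M → ℝ} (hlow : ∀ s ≤ j, σ s = 0)
    (hhigh : ∀ s, k < s → 0 < w s → σ s = 1)
    (hτ : MostSelective ρ c n (scaled w' f) (scaled w' g) τ)
    (hτhigh : ∀ s, k < s → 0 < w' s → τ s = 1) :
    surplus ρ c n (scaled w' f) (scaled w' g) τ ≤ surplus ρ c n (scaled w f) (scaled w g) σ := by
  have hh : 0 < ρ * (1 - c) := mul_pos hρ.1 (by linarith [hc.2])
  have hl : 0 < c * (1 - ρ) := mul_pos hc.1 (by linarith [hρ.2])
  set h := ρ * (1 - c) with hh_def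
  set l := c * (1 - ρ) with hl_def
  have hτs := hτ.1.1
  have hfj : 0 < f j := by
    by_contra h0
    have h1 : f j = 0 := le_antisymm (not_lt.1 h0) (hR.nonnegL j)
    have h2 := hR.pos j
    rw [h1] at h2 hcond1
    nlinarith
  set t := g j / f j with ht_def
  have ht : 0 ≤ t := div_nonneg (hR.nonnegH j) hfj.le
  have hgj : g j = t * f j := by rw [ht_def]; field_simp
  have hle : ∀ s ≤ j, g s ≤ t * f s := fun s hs => by
    have := hR.mono s j hs
    rw [hgj] at this
    exact le_of_mul_le_mul_right (by linarith) hfj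
  have hgk : t * f k ≤ g k := by
    have := hR.mono j k (Fin.le_def.2 (by omega))
    rw [hgj] at this
    exact le_of_mul_le_mul_right (by linarith) hfj
  have hjlt : ∀ s, s ≤ j ∨ s = k ∨ k < s := fun s => by
    simp only [Fin.le_def, Fin.lt_def, Fin.ext_iff]
    omega
  have hB : ∀ x : Fin M → ℝ, ∑ s, w s * x s = 1 → ∑ s, w' s * x s = 1 →
      rej (scaled w x) σ - rej (scaled w' x) τ =
        ∑ s, if s ≤ k then w' s * x s * τ s else 0 := fun x h1 h2 => by
    have e1 : rej (scaled w x) σ = 1 - ∑ s, if s ≤ k then 0 else w' s * x s := by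
      unfold rej scaled
      congr 1
      refine Finset.sum_congr rfl fun s _ => ?_
      rcases hjlt s with hs | rfl | hs
      · rw [hlow s hs, if_pos (hs.trans (Fin.le_def.2 (by omega)))]
        simp
      · simp [hwk]
      · rw [if_neg hs.not_ge]
        have hww : w s = w' s := by
          by_contra h0
          exact hs.not_ge (hdiff s h0)
        rcases (hw.nonneg s).eq_or_lt with h0 | h0
        · simp [← hww, ← h0]
        · rw [hhigh s hs h0, hww, mul_one]
    rw [e1]
    unfold rej scaled
    rw [sub_sub_sub_cancel_left, ← Finset.sum_sub_distrib]
    refine Finset.sum_congr rfl fun s _ => ?_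
    split_ifs with hs
    · simp
    · rcases (hw'.nonneg s).eq_or_lt with h0 | h0
      · simp [← h0]
      · rw [hτhigh s (not_le.1 hs) h0]
        simp
  have hBL := hB f hw.sumL hw'.sumL
  have hBH := hB g hw.sumH hw'.sumH
  have hb : rej (scaled w g) σ ≤ t * rej (scaled w f) σ := by
    rw [rej_eq_sum (p := scaled w g) hw.sumH, rej_eq_sum (p := scaled w f) hw.sumL,
      Finset.mul_sum]
    refine Finset.sum_le_sum fun s _ => ?_
    unfold scaled
    rcases hjlt s with hs | rfl | hs
    · rw [hlow s hs]
      have := mul_le_mul_of_nonneg_left (hle s hs) (hw.nonneg s)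
      linarith
    · simp [hwk]
    · rcases (hw.nonneg s).eq_or_lt with h0 | h0
      · simp [← h0]
      · simp [hhigh s hs h0]
  have hr : rej (scaled w' g) τ ≤ t * rej (scaled w' f) τ := by
    rcases (hτs k).2.eq_or_lt with h1 | h1
    · rw [rej_eq_sum (p := scaled w' g) hw'.sumH, rej_eq_sum (p := scaled w' f) hw'.sumL,
        Finset.mul_sum]
      refine Finset.sum_le_sum fun s _ => ?_
      unfold scaled
      rcases hjlt s with hs | rfl | hs
      · have := mul_le_mul_of_nonneg_left (hle s hs)
          (mul_nonneg (hw'.nonneg s) (sub_nonneg.2 (hτs s).2))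
        linarith
      · simp [h1]
      · rcases (hw'.nonneg s).eq_or_lt with h0 | h0
        · simp [← h0]
        · simp [hτhigh s hs h0]
    · have e : ∀ x : Fin M → ℝ, (∑ s, if s ≤ k then w' s * x s * τ s else 0) =
          w' k * x k * τ k := fun x => by
        rw [Finset.sum_eq_single k]
        · simp
        · intro s _ hs
          split_ifs with hsk
          · rw [hτ.eq_zero_of_lt hρ hc hn hR hw' (lt_of_le_of_ne hsk hs) hwk' h1, mul_zero]
          · rfl
        · simp
      rw [e] at hBL hBH
      have := mul_le_mul_of_nonneg_left hgk (mul_nonneg hwk'.le (hτs k).1)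
      have e1 : rej (scaled w' g) τ = rej (scaled w g) σ - w' k * g k * τ k := by linarith
      have e2 : rej (scaled w' f) τ = rej (scaled w f) σ - w' k * f k * τ k := by linarith
      rw [e1, e2]
      linarith
  have hk : h * t ^ (n - 1) * g k - l * f k ≤ 0 := by
    rw [hgj, mul_pow] at hcond2
    have hp : 0 < f j ^ (n - 1) := pow_pos hfj _
    have : (h * t ^ (n - 1) * g k - l * f k) * f j ^ (n - 1) ≤ 0 := by linarith
    exact nonpos_of_mul_nonpos_left this hp
  have hK : ∀ s ≤ k, h * t ^ (n - 1) * g s ≤ l * f s := fun s hs => by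
    rcases (show 0 ≤ h * t ^ (n - 1) by positivity).eq_or_lt with h0 | h0
    · rw [← h0, zero_mul]
      exact mul_nonneg hl.le (hR.nonnegL s)
    · linarith [hR.gain_nonpos_of_le h0 hs hk]
  have hd : h * t ^ (n - 1) * (rej (scaled w g) σ - rej (scaled w' g) τ) ≤
      l * (rej (scaled w f) σ - rej (scaled w' f) τ) := by
    rw [hBL, hBH, Finset.mul_sum, Finset.mul_sum]
    refine Finset.sum_le_sum fun s _ => ?_
    split_ifs with hs
    · have := mul_le_mul_of_nonneg_left (hK s hs) (mul_nonneg (hw'.nonneg s) (hτs s).1)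
      linarith
    · simp
  have hnonneg : ∀ x : Fin M → ℝ, (∀ s, 0 ≤ x s) →
      0 ≤ ∑ s, if s ≤ k then w' s * x s * τ s else 0 := fun x hx =>
    Finset.sum_nonneg fun s _ => by
      have := hw'.nonneg s
      have := hx s
      have := (hτs s).1
      positivity
  have hmain := weighted_pow_sub_pow_le n hh.le ht (hw'.rejL hR hτs) (hw'.rejH hR hτs)
    (by linarith [hnonneg f hR.nonnegL]) (by linarith [hnonneg g hR.nonnegH]) hb hr hd
  unfold surplus
  rw [hh_def, hl_def] at hmain
  linarith

/-- The comparison of most selective equilibria for two reweightings of the same likelihood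
ratios that differ only up to signal `k = j + 1`. -/
theorem surplus_le_of_weights (hρ : ρ ∈ Set.Ioo (0 : ℝ) 1) (hc : c ∈ Set.Ioo (0 : ℝ) 1)
    (hn : 1 ≤ n) (hR : IsRatio f g) (hw : IsWeight f g w) (hw' : IsWeight f g w')
    {j k : Fin M} (hjk : (k : ℕ) = j + 1) (hdiff : ∀ s, w s ≠ w' s → s ≤ k)
    (hwk : w k = 0) (hwk' : 0 < w' k)
    (hcond1 : ρ * (1 - c) * g j ≤ c * (1 - ρ) * f j)
    (hcond2 : ρ * (1 - c) * g j ^ (n - 1) * g k ≤ c * (1 - ρ) * f j ^ (n - 1) * f k)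
    {τ : Fin M → ℝ} (hσ : MostSelective ρ c n (scaled w f) (scaled w g) σ)
    (hτ : MostSelective ρ c n (scaled w' f) (scaled w' g) τ) :
    surplus ρ c n (scaled w' f) (scaled w' g) τ ≤ surplus ρ c n (scaled w f) (scaled w g) σ := by
  obtain ⟨hσs, hσe⟩ := (isEquilibrium_iff hρ hc hn hR hw).1 hσ.1
  obtain ⟨hτs, hτe⟩ := (isEquilibrium_iff hρ hc hn hR hw').1 hτ.1
  have hlow : ∀ s ≤ j, σ s = 0 := fun s hs => hσ.eq_zero_of_le hρ hc hn hR hw hcond1 hs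
  have hzero : ∀ s ≤ k, σ s = 0 := fun s hs => by
    rcases hs.eq_or_lt with rfl | h
    · exact (hσe s).1 hwk
    · exact hlow s (Fin.le_def.2 (by have := Fin.lt_def.1 h; omega))
  have hdiff' : ∀ s, w' s ≠ w s → s ≤ k := fun s h => hdiff s h.symm
  have hback : (∀ s ≤ k, τ s = 0) → IsEquilibrium ρ c n (scaled w f) (scaled w g) τ :=
    fun hz => hτ.1.congr_weight hρ hc hn hR hw' hw
      (not_lt.1 fun h => by simpa [hz k le_rfl] using (hτe k).2.1 hwk' h) hdiff' hz
  have ha := (hR.gain_weights hρ hc hn hw hσs).1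
  rcases le_or_gt (gain ρ c n (scaled w f) (scaled w g) σ (f k) (g k)) 0 with hk | hk
  · have h1 := hτ.2 σ (hσ.1.congr_weight hρ hc hn hR hw hw' hk hdiff hzero)
    have hτz : ∀ s ≤ k, τ s = 0 := fun s hs =>
      le_antisymm ((h1 s).trans (hzero s hs).le) (hτs s).1
    have h2 : τ = σ := funext fun s => le_antisymm (h1 s) (hσ.2 τ (hback hτz) s)
    rw [h2]
    exact (surplus_congr_weight fun s hs => hzero s (hdiff s hs)).ge
  · have hhigh : ∀ s, k < s → 0 < w s → σ s = 1 := fun s hs h0 => by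
      by_contra h1
      have h2 : gain ρ c n (scaled w f) (scaled w g) σ (f s) (g s) ≤ 0 :=
        not_lt.1 fun h => h1 ((hσe s).2.1 h0 h)
      exact hk.not_ge (hR.gain_nonpos_of_le ha hs.le h2)
    refine surplus_le_of_accept hρ hc hn hR hw hw' hjk hdiff hwk hwk' hcond1 hcond2 hlow
      hhigh hτ fun s hs h0 => ?_
    by_contra h1
    have h2 : τ s < 1 := lt_of_le_of_ne (hτs s).2 h1
    have h3 := hσ.2 τ (hback fun i hi =>
      hτ.eq_zero_of_lt hρ hc hn hR hw' (hi.trans_lt hs) h0 h2) s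
    have hww : w s = w' s := by
      by_contra h4
      exact hs.not_ge (hdiff s h4)
    rw [hhigh s hs (hww ▸ h0)] at h3
    linarith

end Weighted

/-- sufficient condition for a local spread to lower surplus. `E' = (qL,
qH)` differs from `E = (pL, pH)` by a local mean preserving spread at index `j` of the
joint outcome set `Fin M`. If `ρ(1-c)·p_H(s_j) ≤ c(1-ρ)·p_L(s_j)` and
`ρ(1-c)·p_H(s_j)^{n-1}·q_H(s_{j+1}) ≤ c(1-ρ)·p_L(s_j)^{n-1}·q_L(s_{j+1})`, then total
surplus in the most selective equilibrium under `E'` is weakly below that under `E`. -/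
theorem local_spread_sufficient_harm
    (ρ c : ℝ) (hρ : ρ ∈ Set.Ioo (0:ℝ) 1) (hc : c ∈ Set.Ioo (0:ℝ) 1)
    (n : ℕ) (hn : 1 ≤ n) (M : ℕ)
    (pL pH qL qH : Fin M → ℝ)
    (hpL0 : ∀ s, 0 ≤ pL s) (hpH0 : ∀ s, 0 ≤ pH s)
    (hqL0 : ∀ s, 0 ≤ qL s) (hqH0 : ∀ s, 0 ≤ qH s)
    (hpLsum : ∑ s, pL s = 1) (hpHsum : ∑ s, pH s = 1)
    (hqLsum : ∑ s, qL s = 1) (hqHsum : ∑ s, qH s = 1)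
    (hsupp : ∀ s, 0 < pL s + pH s + qL s + qH s)
    (hLR : ∀ i k : Fin M, i ≤ k →
      (pH i + qH i) * (pL k + qL k) ≤ (pH k + qH k) * (pL i + qL i))
    (j : ℕ) (hj1 : 1 ≤ j) (hj2 : j + 1 < M)
    (hqjL : qL ⟨j, by omega⟩ = 0) (hqjH : qH ⟨j, by omega⟩ = 0)
    (hpjmL : pL ⟨j - 1, by omega⟩ = 0) (hpjmH : pH ⟨j - 1, by omega⟩ = 0)
    (hpjpL : pL ⟨j + 1, by omega⟩ = 0) (hpjpH : pH ⟨j + 1, by omega⟩ = 0)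
    (hsplitL : qL ⟨j - 1, by omega⟩ + qL ⟨j + 1, by omega⟩ = pL ⟨j, by omega⟩)
    (hsplitH : qH ⟨j - 1, by omega⟩ + qH ⟨j + 1, by omega⟩ = pH ⟨j, by omega⟩)
    (hagree : ∀ s : Fin M, s.val ≠ j - 1 → s.val ≠ j → s.val ≠ j + 1 →
      qL s = pL s ∧ qH s = pH s)
    (hcond1 : ρ * (1 - c) * pH ⟨j, by omega⟩ ≤ c * (1 - ρ) * pL ⟨j, by omega⟩)
    (hcond2 : ρ * (1 - c) * pH ⟨j, by omega⟩ ^ (n - 1) * qH ⟨j + 1, by omega⟩ ≤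
      c * (1 - ρ) * pL ⟨j, by omega⟩ ^ (n - 1) * qL ⟨j + 1, by omega⟩) :
    ∀ σE σE' : Fin M → ℝ, MostSelective ρ c n pL pH σE →
      MostSelective ρ c n qL qH σE' →
      surplus ρ c n qL qH σE' ≤ surplus ρ c n pL pH σE := by
  intro σE σE' hσ hτ
  let f : Fin M → ℝ := fun s => pL s + qL s
  let g : Fin M → ℝ := fun s => pH s + qH s
  let w : Fin M → ℝ := fun s =>
    if s.val = j then 1 else if s.val = j - 1 ∨ s.val = j + 1 then 0 else 1 / 2
  let w' : Fin M → ℝ := fun s =>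
    if s.val = j then 0 else if s.val = j - 1 ∨ s.val = j + 1 then 1 else 1 / 2
  have hscale : ∀ s, (pL s = w s * f s ∧ pH s = w s * g s) ∧
      (qL s = w' s * f s ∧ qH s = w' s * g s) := by
    rintro ⟨s, hs⟩
    simp only [f, g, w, w']
    by_cases h1 : s = j
    · subst h1
      simp [hqjL, hqjH]
    by_cases h2 : s = j - 1
    · subst h2
      simp [h1, hpjmL, hpjmH]
    by_cases h3 : s = j + 1
    · subst h3
      simp [hpjpL, hpjpH]
    obtain ⟨e1, e2⟩ := hagree ⟨s, hs⟩ h2 h1 h3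
    simp only [h1, h2, h3, if_false, or_self, e1, e2]
    refine ⟨⟨?_, ?_⟩, ?_, ?_⟩ <;> ring
  have epL : pL = scaled w f := funext fun s => (hscale s).1.1
  have epH : pH = scaled w g := funext fun s => (hscale s).1.2
  have eqL : qL = scaled w' f := funext fun s => (hscale s).2.1
  have eqH : qH = scaled w' g := funext fun s => (hscale s).2.2
  have hR : IsRatio f g :=
    ⟨fun s => add_nonneg (hpL0 s) (hqL0 s), fun s => add_nonneg (hpH0 s) (hqH0 s),
      fun s => by simp only [f, g]; linarith [hsupp s], hLR⟩
  have hw : IsWeight f g w :=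
    ⟨fun s => by simp only [w]; split_ifs <;> norm_num,
      by simpa only [epL, scaled] using hpLsum, by simpa only [epH, scaled] using hpHsum⟩
  have hw' : IsWeight f g w' :=
    ⟨fun s => by simp only [w']; split_ifs <;> norm_num,
      by simpa only [eqL, scaled] using hqLsum, by simpa only [eqH, scaled] using hqHsum⟩
  have hfj : f ⟨j, by omega⟩ = pL ⟨j, by omega⟩ := by simp [f, hqjL]
  have hgj : g ⟨j, by omega⟩ = pH ⟨j, by omega⟩ := by simp [g, hqjH]
  have hfk : f ⟨j + 1, hj2⟩ = qL ⟨j + 1, hj2⟩ := by simp [f, hpjpL]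
  have hgk : g ⟨j + 1, hj2⟩ = qH ⟨j + 1, hj2⟩ := by simp [g, hpjpH]
  rw [← hfj, ← hgj] at hcond1 hcond2
  rw [← hfk, ← hgk] at hcond2
  rw [epL, epH] at hσ ⊢
  rw [eqL, eqH] at hτ ⊢
  refine surplus_le_of_weights hρ hc hn hR hw hw' (j := ⟨j, by omega⟩) (k := ⟨j + 1, hj2⟩) rfl
    (fun s hs => ?_) (by simp [w]) (by simp [w']) hcond1 hcond2 hσ hτ
  by_contra hlt
  have hlt' : j + 1 < s.val := not_le.1 hlt
  apply hs
  simp only [w, w']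
  rw [if_neg (by omega), if_neg (by omega), if_neg (by omega), if_neg (by omega)]
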